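/- arXiv:2306.00679 — 6 statements merged into one kernel-verified Lean document; each statement's English description precedes it below -/
import Mathlib

section
/- For every T ∈ ℝ, the function v(t) = (cosh(t − T))^((6−n)/2) is a positive solution on all of ℝ of the sixth-order Emden–Fowler ODE −v⁽⁶⁾ + K₄v⁽⁴⁾ − K₂v″ + K₀v = c_n·v^((n+6)/(n−6)). In particular the spherical solution v_sph(t) = cosh(t)^((6−n)/2) solves this ODE. -/
noncomputable section

def K4 (n : ℕ) : ℝ := (3*(n:ℝ)^2 - 12*(n:ℝ) + 44)/4
def K2 (n : ℕ) : ℝ := (3*(n:ℝ)^4 - 24*(n:ℝ)^3 + 72*(n:ℝ)^2 - 96*(n:ℝ) + 304)/16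
def K0 (n : ℕ) : ℝ := ((n:ℝ)-6)^2*((n:ℝ)-2)^2*((n:ℝ)+2)^2/64
def cst (n : ℕ) : ℝ := ((n:ℝ)-6)*((n:ℝ)-4)*((n:ℝ)-2)*(n:ℝ)*((n:ℝ)+2)*((n:ℝ)+4)/64


lemma hasDerivAt_coshpow (T a s : ℝ) :
    HasDerivAt (fun s => Real.cosh (s - T) ^ a)
      (a * (Real.sinh (s - T) * Real.cosh (s - T) ^ (a - 1))) s := by
  have h1 : HasDerivAt (fun s => Real.cosh (s - T)) (Real.sinh (s - T)) s := by
    simpa using ((hasDerivAt_id s).sub_const T).cosh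
  have h2 := h1.rpow_const (p := a) (Or.inl (Real.cosh_pos _).ne')
  convert h2 using 1
  ring

lemma hasDerivAt_coshpow2 (T a s : ℝ) :
    HasDerivAt (fun s => a * (Real.sinh (s - T) * Real.cosh (s - T) ^ (a - 1)))
      (a ^ 2 * Real.cosh (s - T) ^ a - a * (a - 1) * Real.cosh (s - T) ^ (a - 2)) s := by
  have h1 : HasDerivAt (fun s => Real.sinh (s - T)) (Real.cosh (s - T)) s := by
    simpa using ((hasDerivAt_id s).sub_const T).sinh
  have h2 := (h1.mul (hasDerivAt_coshpow T (a - 1) s)).const_mul a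
  have hc := Real.cosh_pos (s - T)
  refine h2.congr_deriv ?_
  have e1 : Real.cosh (s - T) ^ (a - 1) = Real.cosh (s - T) ^ (a - 2) * Real.cosh (s - T) := by
    rw [← Real.rpow_add_one hc.ne']; congr 1; ring
  have e2 : Real.cosh (s - T) ^ a = Real.cosh (s - T) ^ (a - 2) * Real.cosh (s - T) ^ 2 := by
    rw [← Real.rpow_natCast, ← Real.rpow_add hc]; congr 1; push_cast; ring
  have e3 : a - 1 - 1 = a - 2 := by ring
  rw [e3, e1, e2]
  have := Real.cosh_sq (s - T)
  have hs : Real.sinh (s - T) ^ 2 = Real.cosh (s - T) ^ 2 - 1 := by linarith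
  linear_combination (a * (a - 1) * Real.cosh (s - T) ^ (a - 2)) * hs

lemma iter2_comb (T a b c x y z : ℝ) :
    deriv (deriv (fun s => x * Real.cosh (s - T) ^ a + y * Real.cosh (s - T) ^ b
      + z * Real.cosh (s - T) ^ c)) =
    fun s => x * (a ^ 2 * Real.cosh (s - T) ^ a - a * (a - 1) * Real.cosh (s - T) ^ (a - 2))
      + y * (b ^ 2 * Real.cosh (s - T) ^ b - b * (b - 1) * Real.cosh (s - T) ^ (b - 2))
      + z * (c ^ 2 * Real.cosh (s - T) ^ c - c * (c - 1) * Real.cosh (s - T) ^ (c - 2)) := by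
  have h : deriv (fun s => x * Real.cosh (s - T) ^ a + y * Real.cosh (s - T) ^ b
      + z * Real.cosh (s - T) ^ c) = fun s =>
      x * (a * (Real.sinh (s - T) * Real.cosh (s - T) ^ (a - 1)))
      + y * (b * (Real.sinh (s - T) * Real.cosh (s - T) ^ (b - 1)))
      + z * (c * (Real.sinh (s - T) * Real.cosh (s - T) ^ (c - 1))) := by
    funext s
    exact ((((hasDerivAt_coshpow T a s).const_mul x).add
      ((hasDerivAt_coshpow T b s).const_mul y)).add
      ((hasDerivAt_coshpow T c s).const_mul z)).deriv
  rw [h]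
  funext s
  exact ((((hasDerivAt_coshpow2 T a s).const_mul x).add
      ((hasDerivAt_coshpow2 T b s).const_mul y)).add
      ((hasDerivAt_coshpow2 T c s).const_mul z)).deriv

lemma ode_aux (n : ℕ) (hn : 7 ≤ n) (T t : ℝ) :
    -(iteratedDeriv 6 (fun s => Real.cosh (s - T) ^ (((6:ℝ)-(n:ℝ))/2)) t)
      + K4 n * iteratedDeriv 4 (fun s => Real.cosh (s - T) ^ (((6:ℝ)-(n:ℝ))/2)) t
      - K2 n * iteratedDeriv 2 (fun s => Real.cosh (s - T) ^ (((6:ℝ)-(n:ℝ))/2)) t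
      + K0 n * Real.cosh (t - T) ^ (((6:ℝ)-(n:ℝ))/2)
      = cst n * (Real.cosh (t - T) ^ (((6:ℝ)-(n:ℝ))/2)) ^ (((n:ℝ)+6)/((n:ℝ)-6)) := by
  have hn' : (7:ℝ) ≤ n := by exact_mod_cast hn
  have hpow : (Real.cosh (t - T) ^ (((6:ℝ)-(n:ℝ))/2)) ^ (((n:ℝ)+6)/((n:ℝ)-6))
      = Real.cosh (t - T) ^ (((6:ℝ)-(n:ℝ))/2 - 6) := by
    rw [← Real.rpow_mul (Real.cosh_pos _).le]
    congr 1
    have : (n:ℝ) - 6 ≠ 0 := by linarith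
    field_simp
    ring
  rw [hpow]
  obtain ⟨a, ha⟩ : ∃ a : ℝ, a = ((6:ℝ)-(n:ℝ))/2 := ⟨_, rfl⟩
  rw [← ha]
  have h2 : deriv (deriv (fun s => Real.cosh (s - T) ^ a)) = fun s =>
      a ^ 2 * Real.cosh (s - T) ^ a + (-(a * (a - 1))) * Real.cosh (s - T) ^ (a - 2)
        + 0 * Real.cosh (s - T) ^ (a - 4) := by
    have := iter2_comb T a a a 1 0 0
    simp only [one_mul, zero_mul, add_zero] at this
    rw [this]; funext s; ring
  have h4 : deriv (deriv (deriv (deriv (fun s => Real.cosh (s - T) ^ a)))) = fun s =>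
      a ^ 4 * Real.cosh (s - T) ^ a
        + (-(a * (a - 1)) * (a ^ 2 + (a - 2) ^ 2)) * Real.cosh (s - T) ^ (a - 2)
        + (a * (a - 1) * (a - 2) * (a - 3)) * Real.cosh (s - T) ^ (a - 4) := by
    rw [h2, iter2_comb]
    funext s
    rw [show a - 2 - 2 = a - 4 by ring]
    ring
  have h6 := congrArg (fun f => deriv (deriv f) t) h4
  simp only [iter2_comb] at h6
  rw [show a - 2 - 2 = a - 4 by ring, show a - 4 - 2 = a - 6 by ring] at h6
  simp only [iteratedDeriv_succ, iteratedDeriv_zero]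
  rw [h6, h4, h2]
  have hna : (n:ℝ) = 6 - 2 * a := by rw [ha]; ring
  simp only [K4, K2, K0, cst, hna]
  ring

/-- For every T ∈ ℝ, v(t) = (cosh(t−T))^((6−n)/2) is a positive solution of the
sixth-order Emden–Fowler ODE; in particular so is the spherical solution
v_sph(t) = cosh(t)^((6−n)/2). -/
theorem spherical_solution (n : ℕ) (hn : 7 ≤ n) (T : ℝ) :
    ((∀ t : ℝ, 0 < Real.cosh (t - T) ^ (((6:ℝ)-(n:ℝ))/2)) ∧
      (∀ t : ℝ,
        -(iteratedDeriv 6 (fun s => Real.cosh (s - T) ^ (((6:ℝ)-(n:ℝ))/2)) t)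
          + K4 n * iteratedDeriv 4 (fun s => Real.cosh (s - T) ^ (((6:ℝ)-(n:ℝ))/2)) t
          - K2 n * iteratedDeriv 2 (fun s => Real.cosh (s - T) ^ (((6:ℝ)-(n:ℝ))/2)) t
          + K0 n * Real.cosh (t - T) ^ (((6:ℝ)-(n:ℝ))/2)
          = cst n * (Real.cosh (t - T) ^ (((6:ℝ)-(n:ℝ))/2)) ^ (((n:ℝ)+6)/((n:ℝ)-6))))
    ∧ (∀ t : ℝ,
        -(iteratedDeriv 6 (fun s => Real.cosh s ^ (((6:ℝ)-(n:ℝ))/2)) t)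
          + K4 n * iteratedDeriv 4 (fun s => Real.cosh s ^ (((6:ℝ)-(n:ℝ))/2)) t
          - K2 n * iteratedDeriv 2 (fun s => Real.cosh s ^ (((6:ℝ)-(n:ℝ))/2)) t
          + K0 n * Real.cosh t ^ (((6:ℝ)-(n:ℝ))/2)
          = cst n * (Real.cosh t ^ (((6:ℝ)-(n:ℝ))/2)) ^ (((n:ℝ)+6)/((n:ℝ)-6))) := by
  refine ⟨⟨fun t => Real.rpow_pos_of_pos (Real.cosh_pos _) _, fun t => ode_aux n hn T t⟩, fun t => ?_⟩
  have := ode_aux n hn 0 t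
  simpa only [sub_zero] using this
end
end

section
/- For every x₀ ∈ ℝⁿ and every ε > 0, the function u_{x₀,ε}(x) = (2ε/(1 + ε²|x − x₀|²))^((n−6)/2) is a smooth positive solution on all of ℝⁿ of the sixth-order equation (−Δ)³u = c_n·u^((n+6)/(n−6)), where Δ is the Euclidean Laplacian. -/
noncomputable section

/-- The Euclidean Laplacian Δu(x) = Σᵢ ∂²u/∂xᵢ²(x) on ℝⁿ. -/
def lap {n : ℕ} (u : EuclideanSpace ℝ (Fin n) → ℝ) (x : EuclideanSpace ℝ (Fin n)) : ℝ :=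
  ∑ i : Fin n, fderiv ℝ (fun y => fderiv ℝ u y (EuclideanSpace.single i 1)) x
    (EuclideanSpace.single i 1)

/-- The weight 1 + ε²|y - x₀|². -/
def wt {n : ℕ} (x₀ : EuclideanSpace ℝ (Fin n)) (ε : ℝ) (y : EuclideanSpace ℝ (Fin n)) : ℝ :=
  1 + ε^2 * ‖y - x₀‖^2

theorem wt_pos {n : ℕ} (x₀ : EuclideanSpace ℝ (Fin n)) (ε : ℝ) (y : EuclideanSpace ℝ (Fin n)) :
    0 < wt x₀ ε y := by
  unfold wt; positivity

theorem wt_hasFDerivAt {n : ℕ} (x₀ : EuclideanSpace ℝ (Fin n)) (ε : ℝ)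
    (y : EuclideanSpace ℝ (Fin n)) :
    HasFDerivAt (wt x₀ ε) (ε^2 • ((2:ℝ) • innerSL ℝ (y - x₀))) y := by
  have h := (((hasFDerivAt_id y).sub_const x₀).norm_sq.const_mul (ε^2)).const_add 1
  refine h.congr_fderiv ?_
  ext v
  simp

theorem rpow_hasFDerivAt {n : ℕ} (x₀ : EuclideanSpace ℝ (Fin n)) (ε p : ℝ)
    (y : EuclideanSpace ℝ (Fin n)) :
    HasFDerivAt (fun z => wt x₀ ε z ^ p)
      ((p * wt x₀ ε y ^ (p-1)) • (ε^2 • ((2:ℝ) • innerSL ℝ (y - x₀)))) y :=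
  (wt_hasFDerivAt x₀ ε y).rpow_const (Or.inl (wt_pos x₀ ε y).ne')

theorem fderiv_comb {n : ℕ} (x₀ : EuclideanSpace ℝ (Fin n)) (ε a b c p q r : ℝ)
    (y : EuclideanSpace ℝ (Fin n)) (i : Fin n) :
    fderiv ℝ (fun z => a * wt x₀ ε z ^ p + b * wt x₀ ε z ^ q + c * wt x₀ ε z ^ r) y
      (EuclideanSpace.single i 1)
    = ((a * p * 2 * ε^2) * wt x₀ ε y ^ (p-1) + (b * q * 2 * ε^2) * wt x₀ ε y ^ (q-1)
        + (c * r * 2 * ε^2) * wt x₀ ε y ^ (r-1)) * (y i - x₀ i) := by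
  have h := (((rpow_hasFDerivAt x₀ ε p y).const_mul a).add
    ((rpow_hasFDerivAt x₀ ε q y).const_mul b)).add ((rpow_hasFDerivAt x₀ ε r y).const_mul c)
  have h2 := h.fderiv
  have h3 : (fun z => a * wt x₀ ε z ^ p + b * wt x₀ ε z ^ q + c * wt x₀ ε z ^ r) =
    (((fun z => a * wt x₀ ε z ^ p) + (fun z => b * wt x₀ ε z ^ q)) + fun z => c * wt x₀ ε z ^ r) :=
    rfl
  rw [h3, h2]
  simp [EuclideanSpace.inner_single_right]
  ring

theorem lap_comb {n : ℕ} (x₀ : EuclideanSpace ℝ (Fin n)) (ε a b c p q r : ℝ) :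
    lap (fun z => a * wt x₀ ε z ^ p + b * wt x₀ ε z ^ q + c * wt x₀ ε z ^ r)
    = fun x =>
      a * (2*p*ε^2) * ((n + 2*(p-1)) * wt x₀ ε x ^ (p-1) - 2*(p-1) * wt x₀ ε x ^ (p-1-1)) +
      b * (2*q*ε^2) * ((n + 2*(q-1)) * wt x₀ ε x ^ (q-1) - 2*(q-1) * wt x₀ ε x ^ (q-1-1)) +
      c * (2*r*ε^2) * ((n + 2*(r-1)) * wt x₀ ε x ^ (r-1) - 2*(r-1) * wt x₀ ε x ^ (r-1-1)) := by
  funext x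
  have key : ∀ i : Fin n, fderiv ℝ (fun y => fderiv ℝ
      (fun z => a * wt x₀ ε z ^ p + b * wt x₀ ε z ^ q + c * wt x₀ ε z ^ r) y
      (EuclideanSpace.single i 1)) x (EuclideanSpace.single i 1)
      = ((a * p * 2 * ε^2) * (p-1) * 2 * ε^2 * wt x₀ ε x ^ (p-1-1)
        + (b * q * 2 * ε^2) * (q-1) * 2 * ε^2 * wt x₀ ε x ^ (q-1-1)
        + (c * r * 2 * ε^2) * (r-1) * 2 * ε^2 * wt x₀ ε x ^ (r-1-1)) * (x i - x₀ i)^2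
        + ((a * p * 2 * ε^2) * wt x₀ ε x ^ (p-1) + (b * q * 2 * ε^2) * wt x₀ ε x ^ (q-1)
        + (c * r * 2 * ε^2) * wt x₀ ε x ^ (r-1)) := by
    intro i
    simp only [fderiv_comb]
    have hd : DifferentiableAt ℝ (fun y => (a * p * 2 * ε^2) * wt x₀ ε y ^ (p-1)
        + (b * q * 2 * ε^2) * wt x₀ ε y ^ (q-1) + (c * r * 2 * ε^2) * wt x₀ ε y ^ (r-1)) x :=
      (((rpow_hasFDerivAt x₀ ε (p-1) x).differentiableAt.const_mul _).add
        ((rpow_hasFDerivAt x₀ ε (q-1) x).differentiableAt.const_mul _)).add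
        ((rpow_hasFDerivAt x₀ ε (r-1) x).differentiableAt.const_mul _)
    have hc : HasFDerivAt (fun y : EuclideanSpace ℝ (Fin n) => y i - x₀ i)
        (EuclideanSpace.proj i : EuclideanSpace ℝ (Fin n) →L[ℝ] ℝ) x :=
      (EuclideanSpace.proj i : EuclideanSpace ℝ (Fin n) →L[ℝ] ℝ).hasFDerivAt.sub_const _
    have hm := (hd.hasFDerivAt.mul hc).fderiv
    refine (congrArg (fun L => L (EuclideanSpace.single i 1)) hm).trans ?_
    simp only [add_apply, smul_apply, fderiv_comb]
    simp
    ring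
  have hs : ε^2 * ∑ i : Fin n, (x i - x₀ i)^2 = wt x₀ ε x - 1 := by
    simp [wt, EuclideanSpace.norm_sq_eq]
  unfold lap
  simp only [key]
  rw [Finset.sum_add_distrib, ← Finset.mul_sum]
  simp only [Finset.sum_const, Finset.card_univ, Fintype.card_fin, nsmul_eq_mul]
  have e : ∀ s : ℝ, wt x₀ ε x ^ s = wt x₀ ε x ^ (s-1) * wt x₀ ε x := by
    intro s
    rw [← Real.rpow_add_one (wt_pos x₀ ε x).ne']; congr 1; ring
  rw [e (p-1), e (q-1), e (r-1)]
  generalize wt x₀ ε x ^ (p-1-1) = P at *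
  generalize wt x₀ ε x ^ (q-1-1) = Q at *
  generalize wt x₀ ε x ^ (r-1-1) = R at *
  linear_combination (4*ε^2*(a*p*(p-1)*P + b*q*(q-1)*Q + c*r*(r-1)*R)) * hs

theorem lap_comb' {n : ℕ} (x₀ : EuclideanSpace ℝ (Fin n)) (ε a b c p : ℝ) :
    lap (fun z => a * wt x₀ ε z ^ p + b * wt x₀ ε z ^ (p-1) + c * wt x₀ ε z ^ (p-2))
    = fun x => 2*ε^2 * (
      a * p * (n + 2*(p-1)) * wt x₀ ε x ^ (p-1) +
      (b * (p-1) * (n + 2*(p-2)) - a * p * 2 * (p-1)) * wt x₀ ε x ^ (p-2) +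
      (c * (p-2) * (n + 2*(p-3)) - b * (p-1) * 2 * (p-2)) * wt x₀ ε x ^ (p-3) +
      (- c * (p-2) * 2 * (p-3)) * wt x₀ ε x ^ (p-4)) := by
  rw [lap_comb]
  funext x
  rw [show p-1-1 = p-2 by ring, show p-2-1 = p-3 by ring, show p-3-1 = p-4 by ring]
  ring

/-- For every x₀ ∈ ℝⁿ and ε > 0, the bubble u(x) = (2ε/(1+ε²|x−x₀|²))^((n−6)/2) is a
smooth positive solution on ℝⁿ of (−Δ)³u = c_n·u^((n+6)/(n−6)). -/
theorem bubble_is_solution (n : ℕ) (hn : 7 ≤ n) (x₀ : EuclideanSpace ℝ (Fin n)) (ε : ℝ)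
    (hε : 0 < ε) :
    ContDiff ℝ (⊤ : ℕ∞) (fun x : EuclideanSpace ℝ (Fin n) =>
        (2*ε/(1+ε^2*‖x-x₀‖^2)) ^ (((n:ℝ)-6)/2))
    ∧ (∀ x : EuclideanSpace ℝ (Fin n), 0 < (2*ε/(1+ε^2*‖x-x₀‖^2)) ^ (((n:ℝ)-6)/2))
    ∧ (∀ x : EuclideanSpace ℝ (Fin n),
        -(lap (lap (lap (fun y : EuclideanSpace ℝ (Fin n) =>
            (2*ε/(1+ε^2*‖y-x₀‖^2)) ^ (((n:ℝ)-6)/2)))) x)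
        = cst n * ((2*ε/(1+ε^2*‖x-x₀‖^2)) ^ (((n:ℝ)-6)/2)) ^ (((n:ℝ)+6)/((n:ℝ)-6))) := by
  have hn' : (7:ℝ) ≤ n := by exact_mod_cast hn
  have hpos : ∀ x : EuclideanSpace ℝ (Fin n), 0 < 2*ε/(1+ε^2*‖x-x₀‖^2) := by
    intro x; positivity
  refine ⟨?_, fun x => Real.rpow_pos_of_pos (hpos x) _, ?_⟩
  · refine ContDiff.rpow_const_of_ne ?_ (fun x => (hpos x).ne')
    refine ContDiff.div contDiff_const ?_ (fun x => by positivity)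
    exact contDiff_const.add (contDiff_const.mul ((contDiff_id.sub contDiff_const).norm_sq ℝ))
  · intro x
    set p : ℝ := -(((n:ℝ)-6)/2) with hp
    set A : ℝ := (2*ε) ^ (((n:ℝ)-6)/2) with hA
    have hnp : (n:ℝ) = 6 - 2*p := by rw [hp]; ring
    have h0 : (fun y : EuclideanSpace ℝ (Fin n) => (2*ε/(1+ε^2*‖y-x₀‖^2)) ^ (((n:ℝ)-6)/2))
        = fun z => A * wt x₀ ε z ^ p + 0 * wt x₀ ε z ^ (p-1) + 0 * wt x₀ ε z ^ (p-2) := by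
      funext y
      have hw := wt_pos x₀ ε y
      change (2*ε/wt x₀ ε y) ^ (((n:ℝ)-6)/2) = _
      rw [Real.div_rpow (by positivity) hw.le, hp, Real.rpow_neg hw.le]
      simp [hA, div_eq_mul_inv]
    have h1 : lap (fun z => A * wt x₀ ε z ^ p + 0 * wt x₀ ε z ^ (p-1) + 0 * wt x₀ ε z ^ (p-2))
        = fun z => (8*ε^2*A*p) * wt x₀ ε z ^ (p-1) + (-(4*ε^2*A*p*(p-1))) * wt x₀ ε z ^ (p-1-1)
          + 0 * wt x₀ ε z ^ (p-1-2) := by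
      rw [lap_comb', hnp]
      funext z
      rw [show p-1-1 = p-2 by ring]
      ring
    have h2 : lap (fun z => (8*ε^2*A*p) * wt x₀ ε z ^ (p-1)
          + (-(4*ε^2*A*p*(p-1))) * wt x₀ ε z ^ (p-1-1) + 0 * wt x₀ ε z ^ (p-1-2))
        = fun z => (32*ε^4*A*p*(p-1)) * wt x₀ ε z ^ (p-2)
          + (-(32*ε^4*A*p*(p-1)*(p-2))) * wt x₀ ε z ^ (p-2-1)
          + (16*ε^4*A*p*(p-1)*(p-2)*(p-3)) * wt x₀ ε z ^ (p-2-2) := by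
      rw [lap_comb', hnp]
      funext z
      rw [show p-1-1 = p-2 by ring, show p-2-1 = p-3 by ring, show p-1-2 = p-3 by ring,
        show p-1-3 = p-4 by ring, show p-2-2 = p-4 by ring]
      ring
    have hw := wt_pos x₀ ε x
    have hR : ((2*ε/(1+ε^2*‖x-x₀‖^2)) ^ (((n:ℝ)-6)/2)) ^ (((n:ℝ)+6)/((n:ℝ)-6))
        = A * (2*ε)^6 * wt x₀ ε x ^ (p-6) := by
      change ((2*ε/wt x₀ ε x) ^ (((n:ℝ)-6)/2)) ^ (((n:ℝ)+6)/((n:ℝ)-6)) = _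
      have hne : (n:ℝ) - 6 ≠ 0 := by linarith
      rw [← Real.rpow_mul (by positivity),
        show ((n:ℝ)-6)/2 * (((n:ℝ)+6)/((n:ℝ)-6)) = ((n:ℝ)-6)/2 + (6:ℕ) by
          push_cast; field_simp; ring,
        Real.div_rpow (by positivity) hw.le, Real.rpow_add_natCast (by positivity),
        show p - 6 = -(((n:ℝ)-6)/2 + (6:ℕ)) by rw [hp]; push_cast; ring, Real.rpow_neg hw.le,
        div_eq_mul_inv]
    rw [hR, h0, h1, h2, lap_comb', cst, hnp]
    rw [show p-2-1 = p-3 by ring, show p-2-2 = p-4 by ring, show p-2-3 = p-5 by ring,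
        show p-2-4 = p-6 by ring]
    ring
end
end

section
/- Let v : ℝ → ℝ be six-times continuously differentiable and define u on ℝⁿ \ {0} by u(x) = |x|^((6−n)/2)·v(−ln |x|) (the inverse Emden–Fowler/cylindrical change of variables). Then for every x ≠ 0, (−Δ)³u(x) = |x|^(−(n+6)/2)·(−v⁽⁶⁾ + K₄v⁽⁴⁾ − K₂v″ + K₀v)(−ln |x|). Consequently, u is a positive solution of (−Δ)³u = c_n·u^((n+6)/(n−6)) on ℝⁿ \ {0} if and only if v is a positive solution of the sixth-order Emden–Fowler ODE −v⁽⁶⁾ + K₄v⁽⁴⁾ − K₂v″ + K₀v = c_n·v^((n+6)/(n−6)) on ℝ. -/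
noncomputable section

/-- The sixth-order radial Emden–Fowler operator −v⁽⁶⁾ + K₄v⁽⁴⁾ − K₂v″ + K₀v. -/
def Prad (n : ℕ) (v : ℝ → ℝ) (t : ℝ) : ℝ :=
  -(iteratedDeriv 6 v t) + K4 n * iteratedDeriv 4 v t - K2 n * iteratedDeriv 2 v t + K0 n * v t

lemma ef_hasFDerivAt {n : ℕ} (a : ℝ) (w w1 : ℝ → ℝ) (h : ∀ t, HasDerivAt w (w1 t) t)
    (x : EuclideanSpace ℝ (Fin n)) (hx : x ≠ 0) :
    HasFDerivAt (fun y : EuclideanSpace ℝ (Fin n) => ‖y‖ ^ a * w (-Real.log ‖y‖))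
      ((‖x‖ ^ (a-2) * (a * w (-Real.log ‖x‖) - w1 (-Real.log ‖x‖))) • innerSL ℝ x) x := by
  have hr : 0 < ‖x‖ := norm_pos_iff.mpr hx
  have hn : HasFDerivAt (fun y : EuclideanSpace ℝ (Fin n) => ‖y‖) (‖x‖⁻¹ • innerSL ℝ x) x := by
    have h1 := (hasStrictFDerivAt_norm_sq x).hasFDerivAt
    have h2 := (Real.hasDerivAt_sqrt (x := ‖x‖^2) (by positivity)).comp_hasFDerivAt x h1
    have h3 : (fun y : EuclideanSpace ℝ (Fin n) => ‖y‖) = Real.sqrt ∘ (fun y => ‖y‖^2) := by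
      funext y; simp
    rw [h3]
    refine h2.congr_fderiv ?_
    rw [Real.sqrt_sq hr.le]
    ext z
    simp only [_root_.smul_apply, smul_eq_mul, nsmul_eq_mul]
    field_simp
    simp
  have hg : HasDerivAt (fun r : ℝ => r ^ a * w (-Real.log r))
      (a * ‖x‖ ^ (a-1) * w (-Real.log ‖x‖) + ‖x‖ ^ a * (w1 (-Real.log ‖x‖) * (-(‖x‖⁻¹)))) ‖x‖ := by
    have e1 := Real.hasDerivAt_rpow_const (x := ‖x‖) (p := a) (Or.inl hr.ne')
    have e2 := (h (-Real.log ‖x‖)).comp ‖x‖ (Real.hasDerivAt_log hr.ne').neg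
    exact e1.mul e2
  have := hg.comp_hasFDerivAt x hn
  refine HasFDerivAt.congr_fderiv this ?_
  rw [smul_smul]
  congr 1
  have e1 : ‖x‖ ^ (a-1) = ‖x‖ ^ (a-2) * ‖x‖ := by
    rw [← Real.rpow_add_one hr.ne']; ring_nf
  have e2 : ‖x‖ ^ a = ‖x‖ ^ (a-2) * ‖x‖ * ‖x‖ := by
    rw [← Real.rpow_add_one hr.ne', ← Real.rpow_add_one hr.ne']; ring_nf
  rw [e1, e2]
  field_simp
  ring

lemma ef_lap_congr {n : ℕ} {f g : EuclideanSpace ℝ (Fin n) → ℝ}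
    (h : ∀ x, x ≠ 0 → f x = g x) (x : EuclideanSpace ℝ (Fin n)) (hx : x ≠ 0) :
    lap f x = lap g x := by
  have key : ∀ (f g : EuclideanSpace ℝ (Fin n) → ℝ), (∀ x, x ≠ 0 → f x = g x) →
      ∀ x, x ≠ 0 → fderiv ℝ f x = fderiv ℝ g x := by
    intro f g h x hx
    apply Filter.EventuallyEq.fderiv_eq
    filter_upwards [isOpen_ne.mem_nhds hx] with y hy using h y hy
  unfold lap
  refine Finset.sum_congr rfl fun i _ => ?_
  rw [key _ _ (fun y hy => by rw [key f g h y hy]) x hx]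

lemma ef_lap {n : ℕ} (a : ℝ) (w w1 w2 : ℝ → ℝ) (h : ∀ t, HasDerivAt w (w1 t) t)
    (h1 : ∀ t, HasDerivAt w1 (w2 t) t) (x : EuclideanSpace ℝ (Fin n)) (hx : x ≠ 0) :
    lap (fun y : EuclideanSpace ℝ (Fin n) => ‖y‖ ^ a * w (-Real.log ‖y‖)) x
      = ‖x‖ ^ (a-2) * (fun t => w2 t - (2*a+n-2) * w1 t + a*(a+n-2) * w t) (-Real.log ‖x‖) := by
  have hr : 0 < ‖x‖ := norm_pos_iff.mpr hx
  set W : ℝ → ℝ := fun t => a * w t - w1 t with hW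
  set W1 : ℝ → ℝ := fun t => a * w1 t - w2 t with hW1
  have hWd : ∀ t, HasDerivAt W (W1 t) t := fun t => ((h t).const_mul a).sub (h1 t)
  have main : ∀ i : Fin n, fderiv ℝ (fun y => fderiv ℝ
      (fun y : EuclideanSpace ℝ (Fin n) => ‖y‖ ^ a * w (-Real.log ‖y‖)) y
      (EuclideanSpace.single i 1)) x (EuclideanSpace.single i 1)
      = ‖x‖ ^ (a-2-2) * ((a-2) * W (-Real.log ‖x‖) - W1 (-Real.log ‖x‖)) * (x i)^2
        + ‖x‖ ^ (a-2) * W (-Real.log ‖x‖) := by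
    intro i
    have e : (fun y => fderiv ℝ
      (fun y : EuclideanSpace ℝ (Fin n) => ‖y‖ ^ a * w (-Real.log ‖y‖)) y
      (EuclideanSpace.single i 1)) =ᶠ[nhds x]
      (fun y => (‖y‖ ^ (a-2) * W (-Real.log ‖y‖)) * (EuclideanSpace.proj (𝕜 := ℝ) i) y) := by
      filter_upwards [isOpen_ne.mem_nhds hx] with y hy
      rw [(ef_hasFDerivAt a w w1 h y hy).fderiv]
      simp [hW, EuclideanSpace.inner_single_right]
    have hm : HasFDerivAt
        (fun y => (‖y‖ ^ (a-2) * W (-Real.log ‖y‖)) * (EuclideanSpace.proj (𝕜 := ℝ) i) y) _ x :=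
      (ef_hasFDerivAt (a-2) W W1 hWd x hx).mul (EuclideanSpace.proj (𝕜 := ℝ) i).hasFDerivAt
    rw [e.fderiv_eq, hm.fderiv]
    simp [EuclideanSpace.inner_single_right]
    ring
  unfold lap
  rw [Finset.sum_congr rfl (fun i _ => main i), Finset.sum_add_distrib, ← Finset.mul_sum]
  have hs : ∑ i, (x i)^2 = ‖x‖^2 := by
    rw [EuclideanSpace.norm_sq_eq]; simp
  have e2 : ‖x‖ ^ (a-2) = ‖x‖ ^ (a-2-2) * ‖x‖ * ‖x‖ := by
    rw [← Real.rpow_add_one hr.ne', ← Real.rpow_add_one hr.ne']; ring_nf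
  rw [hs, e2]
  simp [hW, hW1]
  ring

lemma ef_formula (n : ℕ) (v : ℝ → ℝ) (hv : ContDiff ℝ 6 v)
    (x : EuclideanSpace ℝ (Fin n)) (hx : x ≠ 0) :
      -(lap (lap (lap (fun y : EuclideanSpace ℝ (Fin n) =>
            ‖y‖ ^ (((6:ℝ)-(n:ℝ))/2) * v (-Real.log ‖y‖)))) x)
        = ‖x‖ ^ (-(((n:ℝ)+6)/2)) * Prad n v (-Real.log ‖x‖) := by
  have hd : ∀ k : ℕ, k < 6 → ∀ t, HasDerivAt (iteratedDeriv k v) (iteratedDeriv (k+1) v t) t := by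
    intro k hk t
    rw [iteratedDeriv_succ]
    exact ((hv.differentiable_iteratedDeriv k (by exact_mod_cast hk)) t).hasDerivAt
  have d0 : ∀ t, HasDerivAt v (iteratedDeriv 1 v t) t := by
    simpa using hd 0 (by norm_num)
  have d1 := hd 1 (by norm_num)
  have d2 := hd 2 (by norm_num)
  have d3 := hd 3 (by norm_num)
  have d4 := hd 4 (by norm_num)
  have d5 := hd 5 (by norm_num)
  norm_num only at d1 d2 d3 d4 d5
  generalize ha : ((6:ℝ)-(n:ℝ))/2 = a
  have hn : (n:ℝ) = 6 - 2*a := by linarith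
  have M : ∀ (w0 w1 w2 w3 : ℝ → ℝ), (∀ t, HasDerivAt w0 (w1 t) t) →
      (∀ t, HasDerivAt w1 (w2 t) t) → (∀ t, HasDerivAt w2 (w3 t) t) →
      ∀ c d t, HasDerivAt (fun t => w2 t - c * w1 t + d * w0 t)
        ((fun t => w3 t - c * w2 t + d * w1 t) t) t :=
    fun w0 w1 w2 w3 h0 h1 h2 c d t =>
      ((h2 t).sub ((h1 t).const_mul c)).add ((h0 t).const_mul d)
  have s1 := ef_lap (n := n) a _ _ _ d0 d1
  have e0 := M _ _ _ _ d0 d1 d2 (2*a+n-2) (a*(a+n-2))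
  have e1 := M _ _ _ _ d1 d2 d3 (2*a+n-2) (a*(a+n-2))
  have e2 := M _ _ _ _ d2 d3 d4 (2*a+n-2) (a*(a+n-2))
  have e3 := M _ _ _ _ d3 d4 d5 (2*a+n-2) (a*(a+n-2))
  have s2 := ef_lap (n := n) (a-2) _ _ _ e0 e1
  have f0 := M _ _ _ _ e0 e1 e2 (2*(a-2)+n-2) ((a-2)*((a-2)+n-2))
  have f1 := M _ _ _ _ e1 e2 e3 (2*(a-2)+n-2) ((a-2)*((a-2)+n-2))
  have s3 := ef_lap (n := n) (a-2-2) _ _ _ f0 f1 x hx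
  have t2 : ∀ y : EuclideanSpace ℝ (Fin n), y ≠ 0 → _ = _ :=
    fun y hy => (ef_lap_congr s1 y hy).trans (s2 y hy)
  have t3 := (ef_lap_congr t2 x hx).trans s3
  rw [t3]
  have ex : -(((n:ℝ)+6)/2) = a-2-2-2 := by rw [hn]; ring
  rw [ex, ← mul_neg]
  congr 1
  simp only [Prad, K4, K2, K0]
  rw [hn]
  ring

/-- Emden–Fowler (cylindrical) change of variables: with
u(x) = |x|^((6−n)/2)·v(−ln|x|) one has, for x ≠ 0,
(−Δ)³u(x) = |x|^(−(n+6)/2)·(−v⁽⁶⁾ + K₄v⁽⁴⁾ − K₂v″ + K₀v)(−ln|x|);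
consequently u is a positive solution of (−Δ)³u = c_n u^((n+6)/(n−6)) on ℝⁿ∖{0}
iff v is a positive solution of the Emden–Fowler ODE on ℝ. -/
theorem emden_fowler_transform (n : ℕ) (hn : 7 ≤ n) (v : ℝ → ℝ) (hv : ContDiff ℝ 6 v) :
    (∀ x : EuclideanSpace ℝ (Fin n), x ≠ 0 →
      -(lap (lap (lap (fun y : EuclideanSpace ℝ (Fin n) =>
            ‖y‖ ^ (((6:ℝ)-(n:ℝ))/2) * v (-Real.log ‖y‖)))) x)
        = ‖x‖ ^ (-(((n:ℝ)+6)/2)) * Prad n v (-Real.log ‖x‖))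
    ∧ ((∀ x : EuclideanSpace ℝ (Fin n), x ≠ 0 →
          0 < ‖x‖ ^ (((6:ℝ)-(n:ℝ))/2) * v (-Real.log ‖x‖) ∧
          -(lap (lap (lap (fun y : EuclideanSpace ℝ (Fin n) =>
                ‖y‖ ^ (((6:ℝ)-(n:ℝ))/2) * v (-Real.log ‖y‖)))) x)
            = cst n * (‖x‖ ^ (((6:ℝ)-(n:ℝ))/2) * v (-Real.log ‖x‖)) ^ (((n:ℝ)+6)/((n:ℝ)-6)))
        ↔ (∀ t : ℝ, 0 < v t ∧ Prad n v t = cst n * v t ^ (((n:ℝ)+6)/((n:ℝ)-6)))) := by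
  refine ⟨fun x hx => ef_formula n v hv x hx, ?_⟩
  have hn6 : (0:ℝ) < (n:ℝ) - 6 := by
    have : (7:ℝ) ≤ n := by exact_mod_cast hn
    linarith
  have key : ∀ x : EuclideanSpace ℝ (Fin n), x ≠ 0 → 0 < v (-Real.log ‖x‖) →
      (‖x‖ ^ (((6:ℝ)-(n:ℝ))/2) * v (-Real.log ‖x‖)) ^ (((n:ℝ)+6)/((n:ℝ)-6))
        = ‖x‖ ^ (-(((n:ℝ)+6)/2)) * v (-Real.log ‖x‖) ^ (((n:ℝ)+6)/((n:ℝ)-6)) := by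
    intro x hx hp
    rw [Real.mul_rpow (by positivity) hp.le, ← Real.rpow_mul (norm_nonneg x)]
    congr 2
    field_simp
    ring
  constructor
  · intro H t
    have hx0 : (EuclideanSpace.single (⟨0, by omega⟩ : Fin n) (Real.exp (-t))) ≠ 0 := by
      simp [Real.exp_ne_zero]
    have hnorm : ‖EuclideanSpace.single (⟨0, by omega⟩ : Fin n) (Real.exp (-t))‖
        = Real.exp (-t) := by simp
    have ht : -Real.log ‖EuclideanSpace.single (⟨0, by omega⟩ : Fin n) (Real.exp (-t))‖ = t := by
      rw [hnorm]; simp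
    generalize EuclideanSpace.single (⟨0, by omega⟩ : Fin n) (Real.exp (-t)) = x at hx0 hnorm ht
    obtain ⟨h1, h2⟩ := H x hx0
    have hr : 0 < ‖x‖ := norm_pos_iff.mpr hx0
    have hp : 0 < v (-Real.log ‖x‖) := (pos_iff_pos_of_mul_pos h1).mp (by positivity)
    rw [ef_formula n v hv x hx0, key x hx0 hp, mul_left_comm] at h2
    have h3 := mul_left_cancel₀ (by positivity) h2
    rw [ht] at hp h3
    exact ⟨hp, h3⟩
  · intro H x hx
    obtain ⟨hp, h2⟩ := H (-Real.log ‖x‖)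
    have hr : 0 < ‖x‖ := norm_pos_iff.mpr hx
    refine ⟨by positivity, ?_⟩
    rw [ef_formula n v hv x hx, key x hx hp, h2, mul_left_comm]
end
end

section
/- Let v : ℝ → (0,∞) be a six-times continuously differentiable positive solution of the sixth-order Emden–Fowler ODE −v⁽⁶⁾ + K₄v⁽⁴⁾ − K₂v″ + K₀v = c_n·v^((n+6)/(n−6)). Then the Hamiltonian energy H(v)(t) := ½(v‴(t))² + (K₄/2)(v″(t))² + (K₂/2)(v′(t))² − (K₀/2)(v(t))² + v⁽⁵⁾(t)v′(t) − v⁽⁴⁾(t)v″(t) − K₄·v‴(t)v′(t) + (c_n(n−6)/(2n))·v(t)^(2n/(n−6)) is constant in t, i.e. d/dt H(v)(t) = 0 for all t ∈ ℝ. -/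
noncomputable section

/-- The Hamiltonian energy of a function v at time t. -/
def Ham (n : ℕ) (v : ℝ → ℝ) (t : ℝ) : ℝ :=
  (1/2)*(iteratedDeriv 3 v t)^2 + (K4 n/2)*(iteratedDeriv 2 v t)^2 + (K2 n/2)*(deriv v t)^2
    - (K0 n/2)*(v t)^2 + iteratedDeriv 5 v t * deriv v t
    - iteratedDeriv 4 v t * iteratedDeriv 2 v t - K4 n * iteratedDeriv 3 v t * deriv v t
    + (cst n*((n:ℝ)-6)/(2*(n:ℝ))) * v t ^ ((2*(n:ℝ))/((n:ℝ)-6))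

/-- Along any positive C⁶ solution of the sixth-order Emden–Fowler ODE, the Hamiltonian
energy is conserved: d/dt H(v)(t) = 0 for all t. -/
theorem hamiltonian_conserved (n : ℕ) (hn : 7 ≤ n) (v : ℝ → ℝ) (hv : ContDiff ℝ 6 v)
    (hpos : ∀ t, 0 < v t)
    (hsol : ∀ t : ℝ,
      -(iteratedDeriv 6 v t) + K4 n * iteratedDeriv 4 v t - K2 n * iteratedDeriv 2 v t
        + K0 n * v t = cst n * v t ^ (((n:ℝ)+6)/((n:ℝ)-6))) :
    ∀ t : ℝ, deriv (Ham n v) t = 0 := by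
  intro t
  have hd : ∀ k : ℕ, k < 6 → HasDerivAt (iteratedDeriv k v) (iteratedDeriv (k+1) v t) t := by
    intro k hk
    rw [iteratedDeriv_succ]
    exact (hv.differentiable_iteratedDeriv k (by exact_mod_cast hk) t).hasDerivAt
  have h0 : HasDerivAt v (deriv v t) t := by
    have := hd 0 (by norm_num)
    simpa [iteratedDeriv_zero, iteratedDeriv_one] using this
  have h1 : HasDerivAt (deriv v) (iteratedDeriv 2 v t) t := by
    have := hd 1 (by norm_num)
    simpa [iteratedDeriv_one] using this
  have h2 : HasDerivAt (iteratedDeriv 2 v) (iteratedDeriv 3 v t) t := hd 2 (by norm_num)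
  have h3 : HasDerivAt (iteratedDeriv 3 v) (iteratedDeriv 4 v t) t := hd 3 (by norm_num)
  have h4 : HasDerivAt (iteratedDeriv 4 v) (iteratedDeriv 5 v t) t := hd 4 (by norm_num)
  have h5 : HasDerivAt (iteratedDeriv 5 v) (iteratedDeriv 6 v t) t := hd 5 (by norm_num)
  have hp := h0.rpow_const (p := (2*(n:ℝ))/((n:ℝ)-6)) (Or.inl (hpos t).ne')
  have hn7 : (7:ℝ) ≤ n := by exact_mod_cast hn
  have hn0 : (n:ℝ) ≠ 0 := by linarith
  have hn6 : (n:ℝ) - 6 ≠ 0 := by intro h; linarith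
  have he : (2*(n:ℝ))/((n:ℝ)-6) - 1 = ((n:ℝ)+6)/((n:ℝ)-6) := by
    field_simp
    ring
  rw [he] at hp
  have hH := (((((((((h3.pow 2).const_mul (1/2)).add ((h2.pow 2).const_mul (K4 n/2))).add
    ((h1.pow 2).const_mul (K2 n/2))).sub ((h0.pow 2).const_mul (K0 n/2))).add
    (h5.mul h1)).sub (h4.mul h2)).sub ((h3.const_mul (K4 n)).mul h1)).add
    (hp.const_mul (cst n*((n:ℝ)-6)/(2*(n:ℝ)))))
  have hH' : HasDerivAt (Ham n v) _ t := hH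
  rw [hH'.deriv]
  have hs := hsol t
  have hc : cst n*((n:ℝ)-6)/(2*(n:ℝ)) * (deriv v t * ((2*(n:ℝ))/((n:ℝ)-6)) *
      v t ^ (((n:ℝ)+6)/((n:ℝ)-6))) = deriv v t * (cst n * v t ^ (((n:ℝ)+6)/((n:ℝ)-6))) := by
    field_simp
  rw [hc, ← hs]
  push_cast
  ring
end
end

section
/- Let v : ℝ → (0,∞) be a six-times continuously differentiable positive solution of the sixth-order Emden–Fowler ODE −v⁽⁶⁾ + K₄v⁽⁴⁾ − K₂v″ + K₀v = c_n·v^((n+6)/(n−6)) such that v(t), v′(t), v″(t), v‴(t), v⁽⁴⁾(t) and v⁽⁵⁾(t) all tend to 0 as t → +∞. Then the Hamiltonian energy H(v)(t) equals 0 for every t ∈ ℝ. In particular, the spherical solution v_sph(t) = cosh(t)^((6−n)/2) has Hamiltonian energy H(v_sph) = 0. -/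
noncomputable section

open Polynomial in
/-- One differentiation step for `cosh ^ b * P(tanh)`. -/
def polyStep (b : ℝ) (P : Polynomial ℝ) : Polynomial ℝ :=
  Polynomial.C b * X * P + (1 - X ^ 2) * derivative P

lemma polyStep_hasDerivAt (b : ℝ) (P : Polynomial ℝ) (t : ℝ) :
    HasDerivAt (fun s => Real.cosh s ^ b * P.eval (Real.sinh s / Real.cosh s))
      (Real.cosh t ^ b * (polyStep b P).eval (Real.sinh t / Real.cosh t)) t := by
  have hc : 0 < Real.cosh t := Real.cosh_pos t
  have h1 := (Real.hasDerivAt_cosh t).rpow_const (p := b) (Or.inl hc.ne')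
  have h2 := (Real.hasDerivAt_sinh t).div (Real.hasDerivAt_cosh t) hc.ne'
  have h3 := (P.hasDerivAt (Real.sinh t / Real.cosh t)).comp t h2
  refine (h1.mul h3).congr_deriv ?_
  simp only [polyStep, Polynomial.eval_add, Polynomial.eval_mul, Polynomial.eval_C,
    Polynomial.eval_X, Polynomial.eval_sub, Polynomial.eval_one, Polynomial.eval_pow,
    Function.comp, Pi.div_apply]
  rw [Real.rpow_sub_one hc.ne']
  field_simp

lemma iteratedDeriv_cosh_rpow (b : ℝ) (k : ℕ) :
    iteratedDeriv k (fun s => Real.cosh s ^ b) =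
      fun s => Real.cosh s ^ b *
        (((polyStep b)^[k]) 1).eval (Real.sinh s / Real.cosh s) := by
  induction k with
  | zero => simp
  | succ k ih =>
    rw [iteratedDeriv_succ, ih, Function.iterate_succ_apply']
    funext t
    exact (polyStep_hasDerivAt b _ t).deriv

lemma ham_sph (n : ℕ) (hn : 7 ≤ n) (t : ℝ) :
    Ham n (fun s => Real.cosh s ^ (((6:ℝ)-(n:ℝ))/2)) t = 0 := by
  have hn' : (7:ℝ) ≤ n := by exact_mod_cast hn
  have hc : 0 < Real.cosh t := Real.cosh_pos t
  have hp : (Real.cosh t ^ (((6:ℝ)-(n:ℝ))/2)) ^ ((2*(n:ℝ))/((n:ℝ)-6))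
      = (Real.cosh t ^ (((6:ℝ)-(n:ℝ))/2))^2 * (1 - (Real.sinh t / Real.cosh t)^2)^3 := by
    have e : 1 - (Real.sinh t / Real.cosh t)^2 = (Real.cosh t ^ 2)⁻¹ := by
      have := Real.cosh_sq t
      field_simp
      linarith
    rw [e, ← Real.rpow_mul hc.le, ← Real.rpow_natCast (_ ^ _) 2, ← Real.rpow_mul hc.le,
      ← Real.rpow_natCast (Real.cosh t) 2, ← Real.rpow_neg hc.le, ← Real.rpow_natCast _ 3,
      ← Real.rpow_mul hc.le, ← Real.rpow_add hc]
    congr 1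
    have : (n:ℝ) - 6 ≠ 0 := by linarith
    push_cast
    field_simp
    ring
  unfold Ham
  simp only [hp]
  rw [← iteratedDeriv_one]
  simp only [iteratedDeriv_cosh_rpow]
  have hn0 : (n:ℝ) ≠ 0 := by linarith
  simp only [Function.iterate_succ, Function.iterate_zero, Function.comp, id, polyStep, K4, K2, K0, cst]
  generalize Real.sinh t / Real.cosh t = T
  generalize Real.cosh t ^ (((6:ℝ)-(n:ℝ))/2) = w
  simp only [Polynomial.derivative_add, Polynomial.derivative_mul, Polynomial.derivative_sub,
    Polynomial.derivative_one, Polynomial.derivative_X, Polynomial.derivative_C,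
    Polynomial.derivative_X_pow, Polynomial.derivative_zero, mul_zero, zero_mul, mul_one,
    add_zero, zero_add, Polynomial.eval_add, Polynomial.eval_mul, Polynomial.eval_C,
    Polynomial.eval_X, Polynomial.eval_sub, Polynomial.eval_one, Polynomial.eval_pow,
    Polynomial.eval_zero]
  norm_num
  field_simp
  ring

lemma ham_hasDerivAt (n : ℕ) (hn : 7 ≤ n) (v : ℝ → ℝ) (hv : ContDiff ℝ 6 v)
    (hpos : ∀ t, 0 < v t)
    (hsol : ∀ t : ℝ,
      -(iteratedDeriv 6 v t) + K4 n * iteratedDeriv 4 v t - K2 n * iteratedDeriv 2 v t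
        + K0 n * v t = cst n * v t ^ (((n:ℝ)+6)/((n:ℝ)-6))) (t : ℝ) :
    HasDerivAt (Ham n v) 0 t := by
  have hn' : (7:ℝ) ≤ n := by exact_mod_cast hn
  have hd : ∀ k : ℕ, k < 6 → HasDerivAt (iteratedDeriv k v) (iteratedDeriv (k+1) v t) t := by
    intro k hk
    rw [iteratedDeriv_succ]
    exact (hv.differentiable_iteratedDeriv k (by exact_mod_cast hk) t).hasDerivAt
  have h0 := hd 0 (by norm_num)
  have h1 := hd 1 (by norm_num)
  have h2 := hd 2 (by norm_num)
  have h3 := hd 3 (by norm_num)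
  have h4 := hd 4 (by norm_num)
  have h5 := hd 5 (by norm_num)
  norm_num only at h0 h1 h2 h3 h4 h5
  rw [iteratedDeriv_zero] at h0
  have hr := h0.rpow_const (p := (2*(n:ℝ))/((n:ℝ)-6)) (Or.inl (hpos t).ne')
  have key := ((((((((h3.pow 2).const_mul (1/2)).add ((h2.pow 2).const_mul (K4 n/2))).add
    ((h1.pow 2).const_mul (K2 n/2))).sub ((h0.pow 2).const_mul (K0 n/2))).add
    (h5.mul h1)).sub (h4.mul h2)).sub ((h3.const_mul (K4 n)).mul h1)).add
    (hr.const_mul (cst n*((n:ℝ)-6)/(2*(n:ℝ))))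
  have key2 := key.congr_of_eventuallyEq (f₁ := Ham n v) (Filter.Eventually.of_forall fun s => by
    unfold Ham
    rw [← iteratedDeriv_one]
    rfl)
  refine key2.congr_deriv ?_
  have he : (2*(n:ℝ))/((n:ℝ)-6) - 1 = ((n:ℝ)+6)/((n:ℝ)-6) := by
    have : (n:ℝ) - 6 ≠ 0 := by linarith
    field_simp
    ring
  rw [he]
  have hcoef : cst n*((n:ℝ)-6)/(2*(n:ℝ)) * (iteratedDeriv 1 v t * ((2*(n:ℝ))/((n:ℝ)-6)) *
      v t ^ (((n:ℝ)+6)/((n:ℝ)-6)))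
      = iteratedDeriv 1 v t * (cst n * v t ^ (((n:ℝ)+6)/((n:ℝ)-6))) := by
    have : (n:ℝ) - 6 ≠ 0 := by linarith
    have : (n:ℝ) ≠ 0 := by linarith
    field_simp
  rw [hcoef, ← hsol t]
  push_cast
  ring

/-- If v is a positive C⁶ solution of the Emden–Fowler ODE all of whose derivatives of
order ≤ 5 tend to 0 at +∞, then its Hamiltonian energy vanishes identically; in
particular the spherical solution v_sph(t) = cosh(t)^((6−n)/2) has zero energy. -/
theorem hamiltonian_zero_of_decay (n : ℕ) (hn : 7 ≤ n) (v : ℝ → ℝ) (hv : ContDiff ℝ 6 v)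
    (hpos : ∀ t, 0 < v t)
    (hsol : ∀ t : ℝ,
      -(iteratedDeriv 6 v t) + K4 n * iteratedDeriv 4 v t - K2 n * iteratedDeriv 2 v t
        + K0 n * v t = cst n * v t ^ (((n:ℝ)+6)/((n:ℝ)-6)))
    (hdecay : ∀ k : ℕ, k ≤ 5 →
      Filter.Tendsto (fun t => iteratedDeriv k v t) Filter.atTop (nhds 0)) :
    (∀ t : ℝ, Ham n v t = 0)
    ∧ (∀ t : ℝ, Ham n (fun s => Real.cosh s ^ (((6:ℝ)-(n:ℝ))/2)) t = 0) := by
  refine ⟨?_, ham_sph n hn⟩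
  have hn' : (7:ℝ) ≤ n := by exact_mod_cast hn
  have hD := ham_hasDerivAt n hn v hv hpos hsol
  have hconst : ∀ s t, Ham n v s = Ham n v t :=
    is_const_of_deriv_eq_zero (fun t => (hD t).differentiableAt) (fun t => (hD t).deriv)
  have h0 := hdecay 0 (by norm_num)
  have h1 := hdecay 1 (by norm_num)
  have h2 := hdecay 2 (by norm_num)
  have h3 := hdecay 3 (by norm_num)
  have h4 := hdecay 4 (by norm_num)
  have h5 := hdecay 5 (by norm_num)
  simp only [iteratedDeriv_zero] at h0
  have hq : 0 < (2*(n:ℝ))/((n:ℝ)-6) := div_pos (by linarith) (by linarith)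
  have hr := h0.rpow_const (p := (2*(n:ℝ))/((n:ℝ)-6)) (Or.inr hq.le)
  rw [Real.zero_rpow hq.ne'] at hr
  have key := ((((((((h3.pow 2).const_mul (1/2)).add ((h2.pow 2).const_mul (K4 n/2))).add
    ((h1.pow 2).const_mul (K2 n/2))).sub ((h0.pow 2).const_mul (K0 n/2))).add
    (h5.mul h1)).sub (h4.mul h2)).sub ((h3.const_mul (K4 n)).mul h1)).add
    (hr.const_mul (cst n*((n:ℝ)-6)/(2*(n:ℝ))))
  have hlim : Filter.Tendsto (Ham n v) Filter.atTop (nhds 0) := by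
    convert key using 1
    · funext s
      unfold Ham
      rw [← iteratedDeriv_one]
    · norm_num
  intro t
  have hc : Filter.Tendsto (Ham n v) Filter.atTop (nhds (Ham n v t)) :=
    tendsto_const_nhds.congr (fun s => hconst t s)
  exact tendsto_nhds_unique hc hlim
end
end

section
/- There exists a unique β > 0 such that the function ψ(t) = cos(βt) solves the linearization of the sixth-order Emden–Fowler ODE at the cylindrical solution v ≡ ε_*, namely −ψ⁽⁶⁾ + K₄ψ⁽⁴⁾ − K₂ψ″ + K₀ψ = ((n+6)/(n−6))·K₀·ψ on ℝ. Equivalently, β² is the unique positive root of the cubic polynomial x³ + K₄x² + K₂x − (12/(n−6))·K₀. (The fundamental period of the cylinder is then T_cyl := 2π/β.) -/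
noncomputable section

theorem aux_iter_two (β c : ℝ) :
    iteratedDeriv 2 (fun s => c * Real.cos (β*s)) = fun s => (c * -β^2) * Real.cos (β*s) := by
  have h1 : deriv (fun s => c * Real.cos (β*s)) = fun s => c * (-Real.sin (β*s) * (β*1)) := by
    funext s
    exact ((((hasDerivAt_id s).const_mul β).cos).const_mul c).deriv
  rw [iteratedDeriv_succ, iteratedDeriv_one, h1]
  funext s
  have h2 := (((((hasDerivAt_id s).const_mul β).sin).neg.mul_const (β*1)).const_mul c).deriv
  refine Eq.trans h2 ?_
  simp only [id]
  ring

theorem aux_iter_add (f : ℝ → ℝ) (k : ℕ) :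
    iteratedDeriv (k+2) f = iteratedDeriv k (iteratedDeriv 2 f) := by
  simp only [iteratedDeriv_eq_iterate, Function.iterate_add_apply]

theorem aux_iter2 (β : ℝ) :
    iteratedDeriv 2 (fun s => Real.cos (β*s)) = fun s => (-β^2) * Real.cos (β*s) := by
  have := aux_iter_two β 1
  simpa using this

theorem aux_iter4 (β : ℝ) :
    iteratedDeriv 4 (fun s => Real.cos (β*s)) = fun s => (-β^2 * -β^2) * Real.cos (β*s) := by
  rw [aux_iter_add _ 2, aux_iter2, aux_iter_two]

theorem aux_iter6 (β : ℝ) :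
    iteratedDeriv 6 (fun s => Real.cos (β*s))
      = fun s => (-β^2 * -β^2 * -β^2) * Real.cos (β*s) := by
  rw [aux_iter_add _ 4, aux_iter2, aux_iter_add _ 2, aux_iter_two, aux_iter_two]

theorem aux_cubic (a b c : ℝ) (ha : 0 < a) (hb : 0 < b) (hc : 0 < c) :
    ∃! x : ℝ, 0 < x ∧ x^3 + a * x^2 + b * x - c = 0 := by
  have hcont : ContinuousOn (fun x : ℝ => x^3 + a * x^2 + b * x - c) (Set.Icc 0 (c/b)) := by
    fun_prop
  have hcb : 0 < c / b := by positivity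
  have hbc : b * (c/b) = c := by field_simp
  have hm : (0:ℝ) ∈ Set.Icc ((fun x : ℝ => x^3 + a * x^2 + b * x - c) 0)
      ((fun x : ℝ => x^3 + a * x^2 + b * x - c) (c/b)) := by
    constructor
    · simp only []
      linarith
    · have : 0 < (c/b)^3 + a * (c/b)^2 := by positivity
      simp only []
      linarith
  obtain ⟨x, hx, hx0⟩ := intermediate_value_Icc hcb.le hcont hm
  simp only [] at hx0
  have hxpos : 0 < x := by
    rcases hx.1.lt_or_eq with h | h
    · exact h
    · exfalso
      rw [← h] at hx0
      linarith
  refine ⟨x, ⟨hxpos, hx0⟩, ?_⟩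
  rintro y ⟨hy, hy0⟩
  have hf : (y - x) * (y^2 + y*x + x^2 + a * (y + x) + b) = 0 := by linear_combination hy0 - hx0
  have hp : 0 < y^2 + y*x + x^2 + a * (y + x) + b := by positivity
  rcases mul_eq_zero.mp hf with h | h
  · linarith
  · exact absurd h (ne_of_gt hp)

/-- There is a unique β > 0 such that ψ(t) = cos(βt) solves the linearization of the
Emden–Fowler ODE at the cylindrical solution, i.e.
−ψ⁽⁶⁾ + K₄ψ⁽⁴⁾ − K₂ψ″ + K₀ψ = ((n+6)/(n−6))K₀ψ; equivalently, β² is the unique positive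
root of x³ + K₄x² + K₂x − (12/(n−6))K₀. -/
theorem cylinder_indicial_root (n : ℕ) (hn : 7 ≤ n) :
    (∃! β : ℝ, 0 < β ∧ ∀ t : ℝ,
      -(iteratedDeriv 6 (fun s => Real.cos (β*s)) t)
        + K4 n * iteratedDeriv 4 (fun s => Real.cos (β*s)) t
        - K2 n * iteratedDeriv 2 (fun s => Real.cos (β*s)) t
        + K0 n * Real.cos (β*t)
        = (((n:ℝ)+6)/((n:ℝ)-6)) * K0 n * Real.cos (β*t))
    ∧ (∀ β : ℝ, 0 < β →
        ((∀ t : ℝ,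
          -(iteratedDeriv 6 (fun s => Real.cos (β*s)) t)
            + K4 n * iteratedDeriv 4 (fun s => Real.cos (β*s)) t
            - K2 n * iteratedDeriv 2 (fun s => Real.cos (β*s)) t
            + K0 n * Real.cos (β*t)
            = (((n:ℝ)+6)/((n:ℝ)-6)) * K0 n * Real.cos (β*t))
          ↔ (β^2)^3 + K4 n * (β^2)^2 + K2 n * β^2 - (12/((n:ℝ)-6)) * K0 n = 0))
    ∧ (∃! x : ℝ, 0 < x ∧ x^3 + K4 n * x^2 + K2 n * x - (12/((n:ℝ)-6)) * K0 n = 0) := by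
  have hnR : (7:ℝ) ≤ n := by exact_mod_cast hn
  have h6 : (0:ℝ) < (n:ℝ) - 6 := by linarith
  have h2 : (0:ℝ) < (n:ℝ) - 2 := by linarith
  have h4 : 0 < K4 n := by
    unfold K4
    nlinarith
  have hK2 : 0 < K2 n := by
    unfold K2
    obtain ⟨m, hm⟩ : ∃ m : ℝ, (n:ℝ) = m + 7 := ⟨n - 7, by ring⟩
    have hm0 : 0 ≤ m := by linarith
    rw [hm]
    ring_nf
    positivity
  have hK0 : 0 < K0 n := by
    unfold K0
    positivity
  have hc : 0 < (12/((n:ℝ)-6)) * K0 n := by positivity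
  have hfrac : ((n:ℝ)+6)/((n:ℝ)-6) = 1 + 12/((n:ℝ)-6) := by
    field_simp
    ring
  have hcub := aux_cubic _ _ _ h4 hK2 hc
  have key : ∀ β : ℝ,
        ((∀ t : ℝ,
          -(iteratedDeriv 6 (fun s => Real.cos (β*s)) t)
            + K4 n * iteratedDeriv 4 (fun s => Real.cos (β*s)) t
            - K2 n * iteratedDeriv 2 (fun s => Real.cos (β*s)) t
            + K0 n * Real.cos (β*t)
            = (((n:ℝ)+6)/((n:ℝ)-6)) * K0 n * Real.cos (β*t))
          ↔ (β^2)^3 + K4 n * (β^2)^2 + K2 n * β^2 - (12/((n:ℝ)-6)) * K0 n = 0) := by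
    intro β
    rw [aux_iter6, aux_iter4, aux_iter2, hfrac]
    constructor
    · intro h
      have h0 := h 0
      simp only [mul_zero, Real.cos_zero] at h0
      linear_combination h0
    · intro h t
      linear_combination Real.cos (β*t) * h
  refine ⟨?_, fun β _ => key β, hcub⟩
  obtain ⟨x, ⟨hx, hx0⟩, hu⟩ := hcub
  refine ⟨Real.sqrt x, ⟨Real.sqrt_pos.mpr hx, (key _).mpr ?_⟩, ?_⟩
  · rw [Real.sq_sqrt hx.le]
    exact hx0
  · rintro β ⟨hβ, hβ0⟩
    have := hu (β^2) ⟨by positivity, (key β).mp hβ0⟩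
    rw [← this, Real.sqrt_sq hβ.le]
end
end
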